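/- arXiv:2205.08705 — 6 statements merged into one kernel-verified Lean document; each statement's English description precedes it below -/
import Mathlib

section
/- Let n ≥ 3. Let Γ₁ be the signed graph on V = Fin n ⊕ Fin n whose edges are: positive path edges (u_i, u_{i+1}) and (v_i, v_{i+1}) for 0 ≤ i ≤ n-2, a positive edge (u_0, u_{n-1}), a negative edge (u_0, v_0), and a positive edge (u_0, v_{n-1}), and let Γ₁^τ be obtained from Γ₁ by deleting the positive edge (u_0, v_{n-1}) and adding the positive edge (u_{n-1}, v_0). Let Γ₂ be obtained from Γ₁ by changing the edge (u_{n-2}, u_{n-1}) from positive to negative and the edge (u_0, v_0) from negative to positive, and let Γ₃ be obtained from Γ₁^τ by changing the edge (u_{n-2}, u_{n-1}) from positive to negative. Then Γ₂ and Γ₃ are Laplacian cospectral and non-isomorphic. -/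
open Matrix

/-- Vertex set: `Sum.inl i` is `uᵢ`, `Sum.inr i` is `vᵢ` (0-based). -/
abbrev SV (n : ℕ) := Fin n ⊕ Fin n

/-- Signed Laplacian `L = D - A`, where `D` is the diagonal matrix of degrees
`∑ y, |A x y|`. -/
noncomputable def sLap {n : ℕ} (A : Matrix (SV n) (SV n) ℝ) : Matrix (SV n) (SV n) ℝ :=
  Matrix.diagonal (fun x => ∑ y, |A x y|) - A

/-- Symmetrize a one-sided edge-weight function into an adjacency matrix. -/
def sAdj {n : ℕ} (w : SV n → SV n → ℝ) : Matrix (SV n) (SV n) ℝ :=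
  Matrix.of fun x y => w x y + w y x

/-- Edge weights of `Γ₂`, obtained from `Γ₁` (positive paths `u₀⋯u_{n-1}`,
`v₀⋯v_{n-1}`, positive edge `(u₀,u_{n-1})`, negative edge `(u₀,v₀)`, positive edge
`(u₀,v_{n-1})`) by making `(u_{n-2},u_{n-1})` negative and `(u₀,v₀)` positive. -/
def wG2 (n : ℕ) : SV n → SV n → ℝ
  | Sum.inl a, Sum.inl b =>
      if (b : ℕ) = (a : ℕ) + 1 then (if (b : ℕ) = n - 1 then -1 else 1)
      else if (a : ℕ) = 0 ∧ (b : ℕ) = n - 1 then 1 else 0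
  | Sum.inl a, Sum.inr b =>
      if (a : ℕ) = 0 ∧ (b : ℕ) = 0 then 1
      else if (a : ℕ) = 0 ∧ (b : ℕ) = n - 1 then 1 else 0
  | Sum.inr a, Sum.inr b => if (b : ℕ) = (a : ℕ) + 1 then 1 else 0
  | Sum.inr _, Sum.inl _ => 0

/-- Edge weights of `Γ₃`, obtained from the partial transpose `Γ₁^τ` (where
`(u₀,v_{n-1})` is replaced by `(u_{n-1},v₀)`) by making `(u_{n-2},u_{n-1})`
negative. -/
def wG3 (n : ℕ) : SV n → SV n → ℝ
  | Sum.inl a, Sum.inl b =>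
      if (b : ℕ) = (a : ℕ) + 1 then (if (b : ℕ) = n - 1 then -1 else 1)
      else if (a : ℕ) = 0 ∧ (b : ℕ) = n - 1 then 1 else 0
  | Sum.inl a, Sum.inr b =>
      if (a : ℕ) = 0 ∧ (b : ℕ) = 0 then -1
      else if (a : ℕ) = n - 1 ∧ (b : ℕ) = 0 then 1 else 0
  | Sum.inr a, Sum.inr b => if (b : ℕ) = (a : ℕ) + 1 then 1 else 0
  | Sum.inr _, Sum.inl _ => 0

/-- Laplacian-type tridiagonal matrix of a path, with every diagonal entry equal to `2`. -/
def pathLap (n : ℕ) : Matrix (Fin n) (Fin n) ℝ :=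
  Matrix.of fun a b =>
    if (a : ℕ) = b then 2 else if (b : ℕ) = a + 1 ∨ (a : ℕ) = b + 1 then -1 else 0

/-- The switching function that changes the sign at `u_{n-1}` only. -/
def switchLast (n : ℕ) : SV n → ℝ
  | Sum.inl a => if (a : ℕ) = n - 1 then -1 else 1
  | Sum.inr _ => 1

section RankTwo

variable {m : Type*} [DecidableEq m]

/-- The vectors `e_{u_i}` and `e_{u_j} - e_{v_i} - e_{v_j}`. -/
def frame2 (i j : m) : Matrix (Fin 2) (m ⊕ m) ℝ :=
  Matrix.of ![Pi.single (Sum.inl i) 1,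
    Pi.single (Sum.inl j) 1 - Pi.single (Sum.inr i) 1 - Pi.single (Sum.inr j) 1]

/-- The vectors `e_{u_i} + e_{u_j} + e_{v_i}` and `e_{v_j}`. -/
def frame3 (i j : m) : Matrix (Fin 2) (m ⊕ m) ℝ :=
  Matrix.of ![Pi.single (Sum.inl i) 1 + Pi.single (Sum.inl j) 1 + Pi.single (Sum.inr i) 1,
    Pi.single (Sum.inr j) 1]

lemma frame2_zero (i j : m) : frame2 i j 0 = Pi.single (Sum.inl i) 1 := rfl

lemma frame2_one (i j : m) : frame2 i j 1 =
    Pi.single (Sum.inl j) 1 - Pi.single (Sum.inr i) 1 - Pi.single (Sum.inr j) 1 := rfl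

lemma frame3_zero (i j : m) : frame3 i j 0 =
    Pi.single (Sum.inl i) 1 + Pi.single (Sum.inl j) 1 + Pi.single (Sum.inr i) 1 := rfl

lemma frame3_one (i j : m) : frame3 i j 1 = Pi.single (Sum.inr j) 1 := rfl

variable [Fintype m]

lemma frame2_mul_mul_transpose {G : Matrix m m ℝ} {i j : m} (hs : G i j = G j i)
    (hd : G i i = G j j) :
    frame2 i j * fromBlocks G 0 0 G * (frame2 i j)ᵀ =
      !![G i i, G i j; G i j, 3 * G i i + 2 * G i j] := by
  have key (k l : Fin 2) : (frame2 i j * fromBlocks G 0 0 G * (frame2 i j)ᵀ) k l =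
      frame2 i j k ⬝ᵥ fromBlocks G 0 0 G *ᵥ frame2 i j l := by
    rw [Matrix.mul_assoc]; rfl
  ext k l
  rw [key]
  fin_cases k <;> fin_cases l <;>
    (simp [frame2_zero, frame2_one, mulVec_sub, sub_dotProduct, ← hs, ← hd]; try ring)

lemma frame3_mul_mul_transpose {G : Matrix m m ℝ} {i j : m} (hs : G i j = G j i)
    (hd : G i i = G j j) :
    frame3 i j * fromBlocks G 0 0 G * (frame3 i j)ᵀ =
      !![3 * G i i + 2 * G i j, G i j; G i j, G i i] := by
  have key (k l : Fin 2) : (frame3 i j * fromBlocks G 0 0 G * (frame3 i j)ᵀ) k l =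
      frame3 i j k ⬝ᵥ fromBlocks G 0 0 G *ᵥ frame3 i j l := by
    rw [Matrix.mul_assoc]; rfl
  ext k l
  rw [key]
  fin_cases k <;> fin_cases l <;>
    (simp [frame3_zero, frame3_one, mulVec_add, add_dotProduct, ← hs, ← hd]; try ring)

/-- The matrix determinant lemma for a perturbation of the form `Fᵀ * D * F`. -/
lemma det_sub_transpose_mul_mul {ι : Type*} [Fintype ι] [DecidableEq ι] {M : Matrix ι ι ℝ}
    (hM : IsUnit M.det) (F : Matrix (Fin 2) ι ℝ) (D : Matrix (Fin 2) (Fin 2) ℝ) :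
    (M - Fᵀ * D * F).det = M.det * (1 - D * (F * M⁻¹ * Fᵀ)).det := by
  have h : M - Fᵀ * D * F = M * (1 - (M⁻¹ * Fᵀ) * (D * F)) := by
    rw [Matrix.mul_sub, Matrix.mul_one]
    simp only [Matrix.mul_assoc, Matrix.mul_nonsing_inv_cancel_left _ _ hM]
  rw [h, det_mul, det_one_sub_mul_comm]
  simp only [Matrix.mul_assoc]

lemma charpoly_add_frame2_eq_charpoly_add_frame3 {T : Matrix m m ℝ} (hT : T.IsSymm)
    (r : Equiv.Perm m) (hr : T.submatrix r r = T) {i j : m} (hij : r j = i) :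
    (fromBlocks T 0 0 T + (frame2 i j)ᵀ * (!![2, 1; 1, 0] : Matrix (Fin 2) (Fin 2) ℝ) * frame2 i j).charpoly =
      (fromBlocks T 0 0 T + (frame3 i j)ᵀ * (!![1, 0; 0, -1] : Matrix (Fin 2) (Fin 2) ℝ) * frame3 i j).charpoly := by
  refine Polynomial.eq_of_infinite_eval_eq _ _ (Set.Infinite.mono ?_
    (Polynomial.finite_setOfPred_isRoot (charpoly_monic T).ne_zero).infinite_compl)
  intro x hx
  have hdet : (scalar m x - T).det ≠ 0 := by
    rw [← eval_charpoly]; exact hx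
  have hu : IsUnit (scalar m x - T).det := hdet.isUnit
  have hs : (scalar m x - T)⁻¹.IsSymm := by
    rw [IsSymm, transpose_nonsing_inv, transpose_sub, hT.eq]
    simp
  have hrev : (scalar m x - T)⁻¹.submatrix r r = (scalar m x - T)⁻¹ := by
    rw [← inv_submatrix_equiv]
    congr 1
    rw [submatrix_sub, Pi.sub_apply, Pi.sub_apply, hr]
    congr 1
    simp
  have hd : (scalar m x - T)⁻¹ i i = (scalar m x - T)⁻¹ j j := by
    conv_rhs => rw [← hrev]
    rw [submatrix_apply, hij]
  have hblock : scalar (m ⊕ m) x - fromBlocks T 0 0 T =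
      fromBlocks (scalar m x - T) 0 0 (scalar m x - T) := by
    ext (a | a) (b | b) <;> simp [diagonal_apply]
  have hub : IsUnit (fromBlocks (scalar m x - T) 0 0 (scalar m x - T)).det := by
    rw [det_fromBlocks_zero₂₁]; exact hu.mul hu
  have hinv : (fromBlocks (scalar m x - T) 0 0 (scalar m x - T))⁻¹ =
      fromBlocks (scalar m x - T)⁻¹ 0 0 (scalar m x - T)⁻¹ := by
    refine inv_eq_right_inv ?_
    simp only [fromBlocks_multiply, mul_nonsing_inv _ hu, Matrix.mul_zero, Matrix.zero_mul,
      add_zero, zero_add, fromBlocks_one]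
  rw [Set.mem_ofPred_eq, eval_charpoly, eval_charpoly, ← sub_sub, ← sub_sub, hblock,
    det_sub_transpose_mul_mul hub, det_sub_transpose_mul_mul hub, hinv,
    frame2_mul_mul_transpose (hs.apply j i) hd, frame3_mul_mul_transpose (hs.apply j i) hd]
  congr 1
  simp [det_fin_two]
  ring

end RankTwo

lemma sum_ite_val_eq {n : ℕ} (k : ℕ) :
    ∑ b : Fin n, (if (b : ℕ) = k then (1 : ℝ) else 0) = if k < n then 1 else 0 := by
  rw [Fin.sum_univ_eq_sum_range (fun b => if b = k then (1 : ℝ) else 0)]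
  simp

lemma sum_ite_val_succ_eq {n : ℕ} (a : Fin n) :
    ∑ b : Fin n, (if (a : ℕ) = b + 1 then (1 : ℝ) else 0) = if (a : ℕ) = 0 then 0 else 1 := by
  split_ifs with h
  · exact Finset.sum_eq_zero fun b _ => if_neg (by omega)
  · have h' (b : Fin n) : (a : ℕ) = b + 1 ↔ (b : ℕ) = a - 1 := by omega
    simp only [h', sum_ite_val_eq]
    exact if_pos (by omega)

lemma sum_ite_and_val_eq {n : ℕ} (p : Prop) [Decidable p] {k : ℕ} (hk : k < n) :
    ∑ b : Fin n, (if p ∧ (b : ℕ) = k then (1 : ℝ) else 0) = if p then 1 else 0 := by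
  by_cases h : p <;> simp only [h, true_and, false_and, if_true, if_false, sum_ite_val_eq, hk,
    Finset.sum_const_zero]

/-- Degrees of `Γ₂`. -/
lemma sum_abs_sAdj_wG2 {n : ℕ} (hn : 3 ≤ n) (x : SV n) :
    ∑ y, |sAdj (wG2 n) x y| =
      match x with
      | Sum.inl a => if (a : ℕ) = 0 then 4 else 2
      | Sum.inr _ => 2 := by
  obtain a | a := x
  · have h1 (b : Fin n) : |sAdj (wG2 n) (Sum.inl a) (Sum.inl b)| =
        (if (b : ℕ) = a + 1 then 1 else 0) + (if (a : ℕ) = b + 1 then 1 else 0) +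
        (if (a : ℕ) = 0 ∧ (b : ℕ) = n - 1 then 1 else 0) +
        (if (a : ℕ) = n - 1 ∧ (b : ℕ) = 0 then 1 else 0) := by
      simp only [sAdj, wG2, Matrix.of_apply]
      split_ifs <;> first | omega | norm_num
    have h2 (b : Fin n) : |sAdj (wG2 n) (Sum.inl a) (Sum.inr b)| =
        (if (a : ℕ) = 0 ∧ (b : ℕ) = 0 then 1 else 0) +
        (if (a : ℕ) = 0 ∧ (b : ℕ) = n - 1 then 1 else 0) := by
      simp only [sAdj, wG2, Matrix.of_apply]
      split_ifs <;> first | omega | norm_num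
    simp only [Fintype.sum_sum_type, h1, h2, Finset.sum_add_distrib, sum_ite_val_eq,
      sum_ite_val_succ_eq, sum_ite_and_val_eq _ (show n - 1 < n by omega),
      sum_ite_and_val_eq _ (show 0 < n by omega)]
    split_ifs <;> first | omega | norm_num
  · have h1 (b : Fin n) : |sAdj (wG2 n) (Sum.inr a) (Sum.inl b)| =
        (if (a : ℕ) = 0 ∧ (b : ℕ) = 0 then 1 else 0) +
        (if (a : ℕ) = n - 1 ∧ (b : ℕ) = 0 then 1 else 0) := by
      simp only [sAdj, wG2, Matrix.of_apply]
      split_ifs <;> first | omega | norm_num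
    have h2 (b : Fin n) : |sAdj (wG2 n) (Sum.inr a) (Sum.inr b)| =
        (if (b : ℕ) = a + 1 then 1 else 0) + (if (a : ℕ) = b + 1 then 1 else 0) := by
      simp only [sAdj, wG2, Matrix.of_apply]
      split_ifs <;> first | omega | norm_num
    simp only [Fintype.sum_sum_type, h1, h2, Finset.sum_add_distrib, sum_ite_val_eq,
      sum_ite_val_succ_eq, sum_ite_and_val_eq _ (show 0 < n by omega)]
    split_ifs <;> first | omega | norm_num

/-- Degrees of `Γ₃`. -/
lemma sum_abs_sAdj_wG3 {n : ℕ} (hn : 3 ≤ n) (x : SV n) :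
    ∑ y, |sAdj (wG3 n) x y| =
      match x with
      | Sum.inl a => if (a : ℕ) = 0 ∨ (a : ℕ) = n - 1 then 3 else 2
      | Sum.inr a => if (a : ℕ) = 0 then 3 else if (a : ℕ) = n - 1 then 1 else 2 := by
  obtain a | a := x
  · have h1 (b : Fin n) : |sAdj (wG3 n) (Sum.inl a) (Sum.inl b)| =
        (if (b : ℕ) = a + 1 then 1 else 0) + (if (a : ℕ) = b + 1 then 1 else 0) +
        (if (a : ℕ) = 0 ∧ (b : ℕ) = n - 1 then 1 else 0) +
        (if (a : ℕ) = n - 1 ∧ (b : ℕ) = 0 then 1 else 0) := by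
      simp only [sAdj, wG3, Matrix.of_apply]
      split_ifs <;> first | omega | norm_num
    have h2 (b : Fin n) : |sAdj (wG3 n) (Sum.inl a) (Sum.inr b)| =
        (if (a : ℕ) = 0 ∧ (b : ℕ) = 0 then 1 else 0) +
        (if (a : ℕ) = n - 1 ∧ (b : ℕ) = 0 then 1 else 0) := by
      simp only [sAdj, wG3, Matrix.of_apply]
      split_ifs <;> first | omega | norm_num
    simp only [Fintype.sum_sum_type, h1, h2, Finset.sum_add_distrib, sum_ite_val_eq,
      sum_ite_val_succ_eq, sum_ite_and_val_eq _ (show n - 1 < n by omega),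
      sum_ite_and_val_eq _ (show 0 < n by omega)]
    split_ifs <;> first | omega | norm_num
  · have h1 (b : Fin n) : |sAdj (wG3 n) (Sum.inr a) (Sum.inl b)| =
        (if (a : ℕ) = 0 ∧ (b : ℕ) = 0 then 1 else 0) +
        (if (a : ℕ) = 0 ∧ (b : ℕ) = n - 1 then 1 else 0) := by
      simp only [sAdj, wG3, Matrix.of_apply]
      split_ifs <;> first | omega | norm_num
    have h2 (b : Fin n) : |sAdj (wG3 n) (Sum.inr a) (Sum.inr b)| =
        (if (b : ℕ) = a + 1 then 1 else 0) + (if (a : ℕ) = b + 1 then 1 else 0) := by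
      simp only [sAdj, wG3, Matrix.of_apply]
      split_ifs <;> first | omega | norm_num
    simp only [Fintype.sum_sum_type, h1, h2, Finset.sum_add_distrib, sum_ite_val_eq,
      sum_ite_val_succ_eq, sum_ite_and_val_eq _ (show n - 1 < n by omega),
      sum_ite_and_val_eq _ (show 0 < n by omega)]
    split_ifs <;> first | omega | norm_num

lemma single_inl_inl {n : ℕ} (i a : Fin n) :
    (Pi.single (Sum.inl i) 1 : SV n → ℝ) (Sum.inl a) = if (a : ℕ) = i then 1 else 0 := by
  simp [Pi.single_apply, Fin.ext_iff]

lemma single_inr_inr {n : ℕ} (i a : Fin n) :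
    (Pi.single (Sum.inr i) 1 : SV n → ℝ) (Sum.inr a) = if (a : ℕ) = i then 1 else 0 := by
  simp [Pi.single_apply, Fin.ext_iff]

/-- Switching `Γ₂` at `u_{n-1}` exhibits its Laplacian as a rank-two perturbation of two paths. -/
lemma sLap_sAdj_wG2 {n : ℕ} (hn : 3 ≤ n) :
    sLap (sAdj (wG2 n)) = diagonal (switchLast n) *
      ((fromBlocks (pathLap n) 0 0 (pathLap n) +
        (frame2 (⟨0, by omega⟩ : Fin n) ⟨n - 1, by omega⟩)ᵀ * (!![2, 1; 1, 0] : Matrix (Fin 2) (Fin 2) ℝ) *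
          frame2 (⟨0, by omega⟩ : Fin n) ⟨n - 1, by omega⟩) * diagonal (switchLast n)) := by
  ext (a | a) (b | b) <;>
  · rw [diagonal_mul, mul_diagonal, sLap, Matrix.sub_apply, diagonal_apply, sum_abs_sAdj_wG2 hn]
    simp only [sAdj, wG2, switchLast, pathLap, frame2_zero, frame2_one, Matrix.of_apply, Matrix.add_apply, Matrix.mul_apply,
      Fin.sum_univ_two, transpose_apply, fromBlocks_apply₁₁, fromBlocks_apply₁₂,
      fromBlocks_apply₂₁, fromBlocks_apply₂₂, Matrix.zero_apply, cons_val_zero, cons_val_one,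
      Pi.sub_apply, single_inl_inl, single_inr_inr, ne_eq, reduceCtorEq, not_false_eq_true,
      Pi.single_eq_of_ne, Sum.inl.injEq, Sum.inr.injEq, Fin.ext_iff, if_false]
    split_ifs <;> first | omega | norm_num

/-- Switching `Γ₃` at `u_{n-1}` exhibits its Laplacian as a rank-two perturbation of two paths. -/
lemma sLap_sAdj_wG3 {n : ℕ} (hn : 3 ≤ n) :
    sLap (sAdj (wG3 n)) = diagonal (switchLast n) *
      ((fromBlocks (pathLap n) 0 0 (pathLap n) +
        (frame3 (⟨0, by omega⟩ : Fin n) ⟨n - 1, by omega⟩)ᵀ * (!![1, 0; 0, -1] : Matrix (Fin 2) (Fin 2) ℝ) *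
          frame3 (⟨0, by omega⟩ : Fin n) ⟨n - 1, by omega⟩) * diagonal (switchLast n)) := by
  ext (a | a) (b | b) <;>
  · rw [diagonal_mul, mul_diagonal, sLap, Matrix.sub_apply, diagonal_apply, sum_abs_sAdj_wG3 hn]
    simp only [sAdj, wG3, switchLast, pathLap, frame3_zero, frame3_one, Matrix.of_apply, Matrix.add_apply, Matrix.mul_apply,
      Fin.sum_univ_two, transpose_apply, fromBlocks_apply₁₁, fromBlocks_apply₁₂,
      fromBlocks_apply₂₁, fromBlocks_apply₂₂, Matrix.zero_apply, cons_val_zero, cons_val_one,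
      Pi.add_apply, single_inl_inl, single_inr_inr, ne_eq, reduceCtorEq, not_false_eq_true,
      Pi.single_eq_of_ne, Sum.inl.injEq, Sum.inr.injEq, Fin.ext_iff, if_false]
    split_ifs <;> first | omega | norm_num

lemma charpoly_switchLast_conj {n : ℕ} (N : Matrix (SV n) (SV n) ℝ) :
    (diagonal (switchLast n) * (N * diagonal (switchLast n))).charpoly = N.charpoly := by
  have h : diagonal (switchLast n) * diagonal (switchLast n) = 1 := by
    rw [diagonal_mul_diagonal, ← diagonal_one]
    congr 1
    ext (a | a)
    · simp only [switchLast]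
      split_ifs <;> norm_num
    · simp [switchLast]
  rw [charpoly_mul_comm, Matrix.mul_assoc, h, Matrix.mul_one]

lemma isSymm_pathLap (n : ℕ) : (pathLap n).IsSymm := by
  ext a b
  simp only [pathLap, transpose_apply, Matrix.of_apply]
  split_ifs <;> first | omega | rfl

lemma pathLap_submatrix_rev (n : ℕ) :
    (pathLap n).submatrix Fin.revPerm Fin.revPerm = pathLap n := by
  ext a b
  simp only [pathLap, submatrix_apply, Matrix.of_apply, Fin.revPerm_apply, Fin.val_rev]
  split_ifs <;> first | omega | rfl

/-- Permuted signed graphs have the same degrees. -/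
lemma sum_abs_perm {n : ℕ} {A B : Matrix (SV n) (SV n) ℝ} {σ : Equiv.Perm (SV n)}
    (h : ∀ x y, B (σ x) (σ y) = A x y) (x : SV n) : ∑ y, |B (σ x) y| = ∑ y, |A x y| := by
  rw [← Equiv.sum_comp σ]
  simp only [h]

/-- Theorem 3.1(ii): `Γ₂` and `Γ₃` are Laplacian cospectral and non-isomorphic. -/
theorem gamma2_gamma3_laplacianCospectral_nonIsomorphic
    (n : ℕ) (hn : 3 ≤ n) :
    (sLap (sAdj (wG2 n))).charpoly = (sLap (sAdj (wG3 n))).charpoly ∧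
      ¬ ∃ σ : Equiv.Perm (SV n), ∀ x y, sAdj (wG3 n) (σ x) (σ y) = sAdj (wG2 n) x y := by
  constructor
  · rw [sLap_sAdj_wG2 hn, sLap_sAdj_wG3 hn, charpoly_switchLast_conj, charpoly_switchLast_conj]
    refine charpoly_add_frame2_eq_charpoly_add_frame3 (isSymm_pathLap n) Fin.revPerm
      (pathLap_submatrix_rev n) ?_
    ext
    simp only [Fin.revPerm_apply, Fin.val_rev]
    omega
  · rintro ⟨σ, hσ⟩
    have h := sum_abs_perm hσ (Sum.inl ⟨0, by omega⟩)
    rw [sum_abs_sAdj_wG2 hn, sum_abs_sAdj_wG3 hn] at h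
    generalize σ _ = z at h
    obtain a | a := z <;> simp only [if_true] at h <;> split_ifs at h <;> norm_num at h
end

section
/- Let n ≥ 4 and let 0 ≤ i < j ≤ n-2 with j - i ≥ 2, so that u_i and u_j are nonadjacent vertices of the cycle and the edges (u_{j-1}, u_j) and (u_{n-2}, u_{n-1}) are distinct. Let Γ₁ be the signed graph on V = Fin n ⊕ Fin n whose edges are the all-positive cycles u_0 u_1 ⋯ u_{n-1} u_0 and v_0 v_1 ⋯ v_{n-1} v_0, a positive edge (u_i, u_j), a negative edge (u_i, v_i), and a positive edge (u_i, v_j), and let Γ₁^τ be obtained from Γ₁ by deleting the positive edge (u_i, v_j) and adding the positive edge (u_j, v_i). Let Γ₂ be obtained from Γ₁ by changing the edges (u_{n-2}, u_{n-1}) and (u_{j-1}, u_j) from positive to negative and changing the edge (u_i, v_i) from negative to positive, and let Γ₃ be obtained from Γ₁^τ by changing the edges (u_{n-2}, u_{n-1}) and (u_{j-1}, u_j) from positive to negative. Then Γ₂ and Γ₃ are Laplacian cospectral and non-isomorphic. -/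
open Matrix

/-- Edge weights of `Γ₂`, obtained from `Γ₁` (all-positive cycles
`u₀⋯u_{n-1}u₀` and `v₀⋯v_{n-1}v₀`, positive chord `(u_i,u_j)`, negative edge
`(u_i,v_i)`, positive edge `(u_i,v_j)`) by making the cycle edges
`(u_{n-2},u_{n-1})` and `(u_{j-1},u_j)` negative and the edge `(u_i,v_i)`
positive. -/
def wC2 (n i j : ℕ) : SV n → SV n → ℝ
  | Sum.inl a, Sum.inl b =>
      if (b : ℕ) = (a : ℕ) + 1 then
        (if (b : ℕ) = n - 1 ∨ (b : ℕ) = j then -1 else 1)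
      else if (a : ℕ) = 0 ∧ (b : ℕ) = n - 1 then 1
      else if (a : ℕ) = i ∧ (b : ℕ) = j then 1 else 0
  | Sum.inl a, Sum.inr b =>
      if (a : ℕ) = i ∧ (b : ℕ) = i then 1
      else if (a : ℕ) = i ∧ (b : ℕ) = j then 1 else 0
  | Sum.inr a, Sum.inr b =>
      if (b : ℕ) = (a : ℕ) + 1 then 1
      else if (a : ℕ) = 0 ∧ (b : ℕ) = n - 1 then 1 else 0
  | Sum.inr _, Sum.inl _ => 0

/-- Edge weights of `Γ₃`, obtained from the partial transpose `Γ₁^τ` (where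
`(u_i,v_j)` is replaced by `(u_j,v_i)`) by making the cycle edges
`(u_{n-2},u_{n-1})` and `(u_{j-1},u_j)` negative. -/
def wC3 (n i j : ℕ) : SV n → SV n → ℝ
  | Sum.inl a, Sum.inl b =>
      if (b : ℕ) = (a : ℕ) + 1 then
        (if (b : ℕ) = n - 1 ∨ (b : ℕ) = j then -1 else 1)
      else if (a : ℕ) = 0 ∧ (b : ℕ) = n - 1 then 1
      else if (a : ℕ) = i ∧ (b : ℕ) = j then 1 else 0
  | Sum.inl a, Sum.inr b =>
      if (a : ℕ) = i ∧ (b : ℕ) = i then -1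
      else if (a : ℕ) = j ∧ (b : ℕ) = i then 1 else 0
  | Sum.inr a, Sum.inr b =>
      if (b : ℕ) = (a : ℕ) + 1 then 1
      else if (a : ℕ) = 0 ∧ (b : ℕ) = n - 1 then 1 else 0
  | Sum.inr _, Sum.inl _ => 0

theorem Matrix.charpoly_eq_of_involution {R m : Type*} [CommRing R] [Fintype m]
    [DecidableEq m] {P A B : Matrix m m R} (hP : P * P = 1) (h : P * A = B * P) :
    A.charpoly = B.charpoly := by
  have hA : A = P * (B * P) := by rw [← h, ← Matrix.mul_assoc, hP, Matrix.one_mul]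
  rw [hA, Matrix.charpoly_mul_comm, Matrix.mul_assoc, hP, Matrix.mul_one]

theorem abs_sAdj_switch {n : ℕ} {A A' : Matrix (SV n) (SV n) ℝ} {t : SV n → ℝ}
    (ht : ∀ x, t x = 1 ∨ t x = -1) (h : ∀ x y, A x y = t x * t y * A' x y) (x y : SV n) :
    |A x y| = |A' x y| := by
  rw [h]
  rcases ht x with hx | hx <;> rcases ht y with hy | hy <;> simp [hx, hy]

/-- Switching does not change the Laplacian characteristic polynomial. -/
theorem sLap_charpoly_switch {n : ℕ} {A A' : Matrix (SV n) (SV n) ℝ} {t : SV n → ℝ}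
    (ht : ∀ x, t x = 1 ∨ t x = -1) (h : ∀ x y, A x y = t x * t y * A' x y) :
    (sLap A).charpoly = (sLap A').charpoly := by
  have hsq : ∀ x, t x * t x = 1 := fun x => by rcases ht x with hx | hx <;> simp [hx]
  refine Matrix.charpoly_eq_of_involution (P := diagonal t) ?_ ?_
  · rw [diagonal_mul_diagonal]
    simp [hsq]
  · ext x y
    simp only [sLap, diagonal_mul, mul_diagonal, Matrix.sub_apply, abs_sAdj_switch ht h, h x y]
    by_cases hxy : x = y
    · subst hxy
      linear_combination (-t x * A' x x) * hsq x
    · simp only [diagonal_apply_ne _ hxy]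
      linear_combination (-t y * A' x y) * hsq x

section Cycle

variable {n : ℕ}

/-- Adjacency matrix of the cycle on `Fin n`. -/
def cycleAdj (n : ℕ) [NeZero n] : Matrix (Fin n) (Fin n) ℝ :=
  Matrix.of fun a b => (if b = a + 1 then 1 else 0) + (if a = b + 1 then 1 else 0)

/-- Adjacency matrix of the single edge `i j`. -/
def chordAdj (i j : Fin n) : Matrix (Fin n) (Fin n) ℝ :=
  Matrix.of fun a b =>
    (if a = i ∧ b = j then 1 else 0) + (if a = j ∧ b = i then 1 else 0)

/-- Switching representative of `Γ₂`. -/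
def adjTwo [NeZero n] (i j : Fin n) : Matrix (SV n) (SV n) ℝ :=
  fromBlocks (cycleAdj n - chordAdj i j)
    (Matrix.of fun a b => if a = i ∧ (b = i ∨ b = j) then 1 else 0)
    (Matrix.of fun a b => if b = i ∧ (a = i ∨ a = j) then 1 else 0) (cycleAdj n)

/-- Switching representative of `Γ₃`. -/
def adjThree [NeZero n] (i j : Fin n) : Matrix (SV n) (SV n) ℝ :=
  fromBlocks (cycleAdj n - chordAdj i j)
    (Matrix.of fun a b => if b = i ∧ (a = i ∨ a = j) then 1 else 0)
    (Matrix.of fun a b => if a = i ∧ (b = i ∨ b = j) then 1 else 0) (cycleAdj n)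

theorem Fin.eq_add_one_iff_val [NeZero n] (hn : 2 ≤ n) (a b : Fin n) :
    b = a + 1 ↔ (b : ℕ) = a + 1 ∨ ((a : ℕ) = n - 1 ∧ (b : ℕ) = 0) := by
  have ha := a.isLt
  have hb := b.isLt
  rw [Fin.ext_iff, Fin.val_add, Fin.val_one', Nat.mod_eq_of_lt (show 1 < n by omega)]
  by_cases h : (a : ℕ) + 1 < n
  · rw [Nat.mod_eq_of_lt h]
    omega
  · rw [show (a : ℕ) + 1 = n by omega, Nat.mod_self]
    omega

theorem sum_cycleAdj [NeZero n] (a : Fin n) : ∑ b, cycleAdj n a b = 2 := by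
  have h : ∀ b : Fin n, a = b + 1 ↔ b = a - 1 := fun b => by
    rw [eq_sub_iff_add_eq, eq_comm]
  simp only [cycleAdj, of_apply, Finset.sum_add_distrib, h, Finset.sum_ite_eq',
    Finset.mem_univ, if_true]
  norm_num

theorem abs_cycleAdj [NeZero n] (a b : Fin n) : |cycleAdj n a b| = cycleAdj n a b := by
  apply abs_of_nonneg
  simp only [cycleAdj, of_apply]
  positivity

theorem abs_cycleAdj_sub_chordAdj [NeZero n] {i j : Fin n} (h₁ : j ≠ i + 1) (h₂ : i ≠ j + 1)
    (a b : Fin n) :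
    |(cycleAdj n - chordAdj i j) a b| = cycleAdj n a b + chordAdj i j a b := by
  rw [Matrix.sub_apply]
  by_cases hab : (a = i ∧ b = j) ∨ (a = j ∧ b = i)
  · have h0 : cycleAdj n a b = 0 := by
      rcases hab with ⟨rfl, rfl⟩ | ⟨rfl, rfl⟩ <;> simp [cycleAdj, h₁, h₂]
    have hk : 0 ≤ chordAdj i j a b := by
      simp only [chordAdj, of_apply]
      positivity
    rw [h0, zero_sub, abs_neg, abs_of_nonneg hk, zero_add]
  · have h0 : chordAdj i j a b = 0 := by
      rw [not_or] at hab
      simp [chordAdj, hab.1, hab.2]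
    rw [h0, sub_zero, add_zero, abs_cycleAdj]

theorem sum_chordAdj (i j a : Fin n) :
    ∑ b, chordAdj i j a b = (if a = i then 1 else 0) + (if a = j then 1 else 0) := by
  simp [chordAdj, Finset.sum_add_distrib, ite_and]

theorem sum_ite_or_eq {i j : Fin n} (hij : i ≠ j) :
    ∑ b : Fin n, (if b = i ∨ b = j then (1 : ℝ) else 0) = 2 := by
  have h : ∀ b : Fin n, (if b = i ∨ b = j then (1 : ℝ) else 0)
      = (if b = i then 1 else 0) + (if b = j then 1 else 0) := fun b => by
    by_cases h₁ : b = i <;> by_cases h₂ : b = j <;> simp_all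
  simp only [h, Finset.sum_add_distrib, Finset.sum_ite_eq', Finset.mem_univ, if_true]
  norm_num

theorem abs_ite_one_zero (p : Prop) [Decidable p] :
    |(if p then (1 : ℝ) else 0)| = if p then 1 else 0 := by
  split_ifs <;> simp

theorem degree_adjTwo [NeZero n] {i j : Fin n} (hij : i ≠ j) (h₁ : j ≠ i + 1) (h₂ : i ≠ j + 1)
    (x : SV n) :
    ∑ y, |adjTwo i j x y| = Sum.elim
      (fun a => 2 + (if a = i then 3 else 0) + (if a = j then 1 else 0))
      (fun a => 2 + (if a = i then 1 else 0) + (if a = j then 1 else 0)) x := by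
  rcases x with a | a
  · simp only [adjTwo, Fintype.sum_sum_type, fromBlocks_apply₁₁, fromBlocks_apply₁₂,
      abs_cycleAdj_sub_chordAdj h₁ h₂, Finset.sum_add_distrib, sum_cycleAdj, sum_chordAdj,
      of_apply, abs_ite_one_zero, Sum.elim_inl]
    by_cases ha : a = i
    · simp only [ha, true_and, sum_ite_or_eq hij, if_true, hij, if_false]
      norm_num
    · simp [ha]
  · simp only [adjTwo, Fintype.sum_sum_type, fromBlocks_apply₂₁, fromBlocks_apply₂₂,
      abs_cycleAdj, sum_cycleAdj, of_apply, abs_ite_one_zero, Sum.elim_inr]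
    by_cases ha : a = i
    · simp [ha, hij]; norm_num
    · by_cases hb : a = j
      · simp [hb, hij.symm]; norm_num
      · simp [ha, hb]

theorem degree_adjThree [NeZero n] {i j : Fin n} (hij : i ≠ j) (h₁ : j ≠ i + 1) (h₂ : i ≠ j + 1)
    (x : SV n) :
    ∑ y, |adjThree i j x y| = Sum.elim
      (fun a => 2 + (if a = i then 2 else 0) + (if a = j then 2 else 0))
      (fun a => 2 + (if a = i then 2 else 0)) x := by
  rcases x with a | a
  · simp only [adjThree, Fintype.sum_sum_type, fromBlocks_apply₁₁, fromBlocks_apply₁₂,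
      abs_cycleAdj_sub_chordAdj h₁ h₂, Finset.sum_add_distrib, sum_cycleAdj, sum_chordAdj,
      of_apply, abs_ite_one_zero, Sum.elim_inl]
    by_cases ha : a = i
    · simp [ha, hij]; norm_num
    · by_cases hb : a = j
      · simp [hb, hij.symm]; norm_num
      · simp [ha, hb]
  · simp only [adjThree, Fintype.sum_sum_type, fromBlocks_apply₂₁, fromBlocks_apply₂₂,
      abs_cycleAdj, sum_cycleAdj, of_apply, abs_ite_one_zero, Sum.elim_inr]
    by_cases ha : a = i
    · simp only [ha, true_and, sum_ite_or_eq hij, if_true]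
    · simp [ha]

/-- Laplacian of two disjoint cycles. -/
def twoCycleLap (n : ℕ) [NeZero n] : Matrix (SV n) (SV n) ℝ :=
  fromBlocks (2 - cycleAdj n) 0 0 (2 - cycleAdj n)

theorem sLap_adjTwo [NeZero n] {i j : Fin n} (hij : i ≠ j) (h₁ : j ≠ i + 1) (h₂ : i ≠ j + 1) :
    sLap (adjTwo i j) = twoCycleLap n
      + vecMulVec (Sum.elim (Pi.single i 1 + Pi.single j 1) 0)
          (Sum.elim (Pi.single i 1 + Pi.single j 1) 0)
      + vecMulVec (Sum.elim (Pi.single i 1) (-Pi.single i 1))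
          (Sum.elim (Pi.single i 1) (-Pi.single i 1))
      + vecMulVec (Sum.elim (Pi.single i 1) (-Pi.single j 1))
          (Sum.elim (Pi.single i 1) (-Pi.single j 1)) := by
  ext x y
  simp only [sLap, degree_adjTwo hij h₁ h₂]
  rcases x with a | a <;> rcases y with b | b <;>
    simp [adjTwo, twoCycleLap, chordAdj, vecMulVec_apply, Pi.single_apply, diagonal_apply,
      Matrix.ofNat_apply] <;>
    by_cases hai : a = i <;> by_cases haj : a = j <;> by_cases hbi : b = i <;>
    by_cases hbj : b = j <;> by_cases hab : a = b <;> simp_all <;> ring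

theorem sLap_adjThree [NeZero n] {i j : Fin n} (hij : i ≠ j) (h₁ : j ≠ i + 1) (h₂ : i ≠ j + 1) :
    sLap (adjThree i j) = twoCycleLap n
      + vecMulVec (Sum.elim (Pi.single i 1 + Pi.single j 1) 0)
          (Sum.elim (Pi.single i 1 + Pi.single j 1) 0)
      + vecMulVec (Sum.elim (Pi.single i 1) (-Pi.single i 1))
          (Sum.elim (Pi.single i 1) (-Pi.single i 1))
      + vecMulVec (Sum.elim (Pi.single j 1) (-Pi.single i 1))
          (Sum.elim (Pi.single j 1) (-Pi.single i 1)) := by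
  ext x y
  simp only [sLap, degree_adjThree hij h₁ h₂]
  rcases x with a | a <;> rcases y with b | b <;>
    simp [adjThree, twoCycleLap, chordAdj, vecMulVec_apply, Pi.single_apply, diagonal_apply,
      Matrix.ofNat_apply] <;>
    by_cases hai : a = i <;> by_cases haj : a = j <;> by_cases hbi : b = i <;>
    by_cases hbj : b = j <;> by_cases hab : a = b <;> simp_all <;> ring

/-- Permutation matrix of the reflection `a ↦ c - a` of the cycle. -/
def reflection (c : Fin n) : Matrix (Fin n) (Fin n) ℝ :=
  Matrix.of fun a b => if b = c - a then 1 else 0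

theorem reflection_mul_apply (c : Fin n) (X : Matrix (Fin n) (Fin n) ℝ) (a b : Fin n) :
    (reflection c * X) a b = X (c - a) b := by
  simp [reflection, mul_apply]

theorem mul_reflection_apply [NeZero n] (c : Fin n) (X : Matrix (Fin n) (Fin n) ℝ) (a b : Fin n) :
    (X * reflection c) a b = X a (c - b) := by
  have h : ∀ k : Fin n, b = c - k ↔ k = c - b := fun k => by
    constructor <;> rintro rfl <;> abel
  simp [reflection, mul_apply, h]

theorem reflection_mul_self [NeZero n] (c : Fin n) : reflection c * reflection c = 1 := by
  ext a b
  rw [reflection_mul_apply]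
  simp [reflection, one_apply, eq_comm]

theorem reflection_transpose [NeZero n] (c : Fin n) : (reflection c)ᵀ = reflection c := by
  ext a b
  have h : a = c - b ↔ b = c - a := by
    constructor <;> rintro rfl <;> abel
  simp [reflection, h]

theorem reflection_mul_cycleAdj [NeZero n] (c : Fin n) :
    reflection c * cycleAdj n = cycleAdj n * reflection c := by
  ext a b
  rw [reflection_mul_apply, mul_reflection_apply]
  have h₁ : b = c - a + 1 ↔ a = c - b + 1 := by
    constructor <;> rintro rfl <;> abel
  have h₂ : c - a = b + 1 ↔ c - b = a + 1 := by
    rw [sub_eq_iff_eq_add, sub_eq_iff_eq_add]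
    constructor <;> rintro rfl <;> abel
  simp only [cycleAdj, of_apply, h₁, h₂]
  ring

theorem reflection_mulVec_single [NeZero n] (c i : Fin n) :
    reflection c *ᵥ Pi.single i 1 = Pi.single (c - i) (1 : ℝ) := by
  ext a
  have h : i = c - a ↔ a = c - i := by
    constructor <;> rintro rfl <;> abel
  simp [reflection, Pi.single_apply, h]

/-- The involution acting as the identity on reflection-symmetric vectors and as the negated
exchange of the two cycles on reflection-antisymmetric ones. -/
noncomputable def exchange (c : Fin n) : Matrix (SV n) (SV n) ℝ :=
  (1 / 2 : ℝ) • fromBlocks (1 + reflection c) (reflection c - 1)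
    (reflection c - 1) (1 + reflection c)

theorem exchange_mul_self [NeZero n] (c : Fin n) : exchange c * exchange c = 1 := by
  have h := reflection_mul_self c
  have e₁ : (1 + reflection c) * (1 + reflection c)
      + (reflection c - 1) * (reflection c - 1) = (4 : ℝ) • 1 := by
    simp only [mul_add, add_mul, mul_sub, sub_mul, h, Matrix.one_mul, Matrix.mul_one]
    module
  have e₂ : (1 + reflection c) * (reflection c - 1)
      + (reflection c - 1) * (1 + reflection c) = 0 := by
    simp only [mul_add, add_mul, mul_sub, sub_mul, h, Matrix.one_mul, Matrix.mul_one]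
    module
  rw [exchange, smul_mul_smul_comm, fromBlocks_multiply, e₁, e₂, add_comm, e₂,
    add_comm ((reflection c - 1) * _), e₁]
  rw [← fromBlocks_one, fromBlocks_smul]
  norm_num [smul_smul]

theorem exchange_transpose [NeZero n] (c : Fin n) : (exchange c)ᵀ = exchange c := by
  simp [exchange, fromBlocks_transpose, reflection_transpose]

theorem exchange_mul_twoCycleLap [NeZero n] (c : Fin n) :
    exchange c * twoCycleLap n = twoCycleLap n * exchange c := by
  have h : reflection c * (2 - cycleAdj n) = (2 - cycleAdj n) * reflection c := by
    rw [mul_sub, sub_mul, reflection_mul_cycleAdj, mul_two, two_mul]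
  simp only [exchange, twoCycleLap, smul_mul_assoc, mul_smul_comm, fromBlocks_multiply,
    Matrix.mul_zero, Matrix.zero_mul, add_zero, zero_add, Matrix.add_mul, Matrix.mul_add, h,
    Matrix.sub_mul _ _ (2 - cycleAdj n), Matrix.mul_sub (2 - cycleAdj n), Matrix.one_mul,
    Matrix.mul_one]

theorem exchange_mulVec (c : Fin n) (v w : Fin n → ℝ) :
    exchange c *ᵥ Sum.elim v w = (1 / 2 : ℝ) • Sum.elim
      (v + reflection c *ᵥ v + (reflection c *ᵥ w - w))
      (reflection c *ᵥ v - v + (w + reflection c *ᵥ w)) := by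
  rw [exchange, smul_mulVec, fromBlocks_mulVec]
  simp [add_mulVec, sub_mulVec]

theorem exchange_mul_vecMulVec [NeZero n] {c : Fin n} {x y : SV n → ℝ} (h : exchange c *ᵥ x = y) :
    exchange c * vecMulVec x x = vecMulVec y y * exchange c := by
  have h' : y ᵥ* exchange c = x := by
    rw [← mulVec_transpose, exchange_transpose, ← h, mulVec_mulVec, exchange_mul_self, one_mulVec]
  rw [mul_vecMulVec, vecMulVec_mul, h, h']

theorem adjTwo_adjThree_cospectral [NeZero n] {i j : Fin n} (hij : i ≠ j) (h₁ : j ≠ i + 1)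
    (h₂ : i ≠ j + 1) : (sLap (adjTwo i j)).charpoly = (sLap (adjThree i j)).charpoly := by
  have hi : reflection (i + j) *ᵥ Pi.single i 1 = Pi.single j (1 : ℝ) := by
    rw [reflection_mulVec_single, add_sub_cancel_left]
  have hj : reflection (i + j) *ᵥ Pi.single j 1 = Pi.single i (1 : ℝ) := by
    rw [reflection_mulVec_single, add_sub_cancel_right]
  refine Matrix.charpoly_eq_of_involution (exchange_mul_self (i + j)) ?_
  rw [sLap_adjTwo hij h₁ h₂, sLap_adjThree hij h₁ h₂]
  simp only [Matrix.mul_add, Matrix.add_mul]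
  congr 1
  · congr 1
    · congr 1
      · exact exchange_mul_twoCycleLap _
      · refine exchange_mul_vecMulVec ?_
        rw [exchange_mulVec]
        ext (a | a) <;> simp [mulVec_add, hi, hj] <;> ring
    · refine exchange_mul_vecMulVec ?_
      rw [exchange_mulVec]
      ext (a | a) <;> simp [mulVec_neg, hi] <;> ring
  · refine exchange_mul_vecMulVec ?_
    rw [exchange_mulVec]
    ext (a | a) <;> simp [mulVec_neg, hi, hj] <;> ring

/-- Switching signs on the first cycle: negative exactly at `u_j, …, u_{n-2}`. -/
def arcSign (j : Fin n) (a : Fin n) : ℝ := if (j : ℕ) ≤ a ∧ (a : ℕ) ≤ n - 2 then -1 else 1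

theorem arcSign_eq (j a : Fin n) : arcSign j a = 1 ∨ arcSign j a = -1 := by
  unfold arcSign
  split_ifs <;> simp

theorem wC2_inl_inl [NeZero n] {i j : Fin n} (hn : 4 ≤ n) (hj : (j : ℕ) ≤ n - 2)
    (hgap : (i : ℕ) + 2 ≤ j) (a b : Fin n) :
    wC2 n i j (Sum.inl a) (Sum.inl b) = arcSign j a * arcSign j b
      * ((if b = a + 1 ∧ (a : ℕ) < b then 1 else 0) + (if a = b + 1 ∧ (a : ℕ) < b then 1 else 0)
        - (if a = i ∧ b = j then 1 else 0)) := by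
  have ha := a.isLt
  have hb := b.isLt
  simp only [wC2, arcSign, Fin.eq_add_one_iff_val (show 2 ≤ n by omega), Fin.ext_iff]
  split_ifs <;> first | omega | norm_num

theorem sAdj_wC2_inl_inl [NeZero n] {i j : Fin n} (hn : 4 ≤ n) (hj : (j : ℕ) ≤ n - 2)
    (hgap : (i : ℕ) + 2 ≤ j) (a b : Fin n) :
    sAdj (wC2 n i j) (Sum.inl a) (Sum.inl b)
      = arcSign j a * arcSign j b * (cycleAdj n - chordAdj i j) a b := by
  have hne : ∀ a b : Fin n, b = a + 1 → (a : ℕ) ≠ b := fun a b h => by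
    have := (Fin.eq_add_one_iff_val (by omega) a b).1 h
    omega
  have h : ∀ a b : Fin n, (if b = a + 1 then (1 : ℝ) else 0)
      = (if b = a + 1 ∧ (a : ℕ) < b then 1 else 0)
        + (if b = a + 1 ∧ (b : ℕ) < a then 1 else 0) := fun a b => by
    have := hne a b
    by_cases hab : b = a + 1
    · rcases lt_or_gt_of_ne (this hab) with hlt | hlt
      · simp only [hab.symm, hlt, hlt.not_gt, and_self, and_false, if_true, if_false, add_zero]
      · simp only [hab.symm, hlt, hlt.not_gt, and_self, and_false, if_true, if_false, zero_add]
    · simp [hab]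
  simp only [sAdj, of_apply, wC2_inl_inl hn hj hgap, Matrix.sub_apply, cycleAdj, chordAdj,
    h a b, h b a, and_comm (a := a = j)]
  ring

theorem sAdj_wC2_switch [NeZero n] {i j : Fin n} (hn : 4 ≤ n) (hj : (j : ℕ) ≤ n - 2)
    (hgap : (i : ℕ) + 2 ≤ j) (x y : SV n) :
    sAdj (wC2 n i j) x y = Sum.elim (arcSign j) 1 x * Sum.elim (arcSign j) 1 y
      * adjTwo i j x y := by
  rcases x with a | a <;> rcases y with b | b
  · exact sAdj_wC2_inl_inl hn hj hgap a b
  all_goals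
    have ha := a.isLt
    have hb := b.isLt
    simp only [sAdj, wC2, of_apply, cycleAdj, arcSign, adjTwo, fromBlocks_apply₁₂,
      fromBlocks_apply₂₁, fromBlocks_apply₂₂, Sum.elim_inl, Sum.elim_inr, Pi.one_apply,
      Fin.eq_add_one_iff_val (show 2 ≤ n by omega), Fin.ext_iff]
    split_ifs <;> first | omega | norm_num

theorem sAdj_wC3_switch [NeZero n] {i j : Fin n} (hn : 4 ≤ n) (hj : (j : ℕ) ≤ n - 2)
    (hgap : (i : ℕ) + 2 ≤ j) (x y : SV n) :
    sAdj (wC3 n i j) x y = Sum.elim (arcSign j) (-1) x * Sum.elim (arcSign j) (-1) y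
      * adjThree i j x y := by
  rcases x with a | a <;> rcases y with b | b
  · exact sAdj_wC2_inl_inl hn hj hgap a b
  all_goals
    have ha := a.isLt
    have hb := b.isLt
    simp only [sAdj, wC3, of_apply, cycleAdj, arcSign, adjThree, fromBlocks_apply₁₂,
      fromBlocks_apply₂₁, fromBlocks_apply₂₂, Sum.elim_inl, Sum.elim_inr, Pi.neg_apply,
      Pi.one_apply, Fin.eq_add_one_iff_val (show 2 ≤ n by omega), Fin.ext_iff]
    split_ifs <;> first | omega | norm_num

end Cycle

/-- Theorem 3.2(ii): `Γ₂` and `Γ₃` are Laplacian cospectral and non-isomorphic. -/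
theorem cycleGamma2_gamma3_laplacianCospectral_nonIsomorphic
    (n i j : ℕ) (hn : 4 ≤ n) (hij : i < j) (hj : j ≤ n - 2) (hgap : 2 ≤ j - i) :
    (sLap (sAdj (wC2 n i j))).charpoly = (sLap (sAdj (wC3 n i j))).charpoly ∧
      ¬ ∃ σ : Equiv.Perm (SV n), ∀ x y,
          sAdj (wC3 n i j) (σ x) (σ y) = sAdj (wC2 n i j) x y := by
  have : NeZero n := ⟨by omega⟩
  obtain ⟨i, rfl⟩ : ∃ i' : Fin n, (i' : ℕ) = i := ⟨⟨i, by omega⟩, rfl⟩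
  obtain ⟨j, rfl⟩ : ∃ j' : Fin n, (j' : ℕ) = j := ⟨⟨j, by omega⟩, rfl⟩
  have hgap' : (i : ℕ) + 2 ≤ j := by omega
  have hne : i ≠ j := fun h => by rw [h] at hij; omega
  have h₁ : j ≠ i + 1 := by
    rw [Ne, Fin.eq_add_one_iff_val (by omega)]
    omega
  have h₂ : i ≠ j + 1 := by
    rw [Ne, Fin.eq_add_one_iff_val (by omega)]
    omega
  have ht₂ : ∀ x, Sum.elim (arcSign j) (1 : Fin n → ℝ) x = 1
      ∨ Sum.elim (arcSign j) (1 : Fin n → ℝ) x = -1 := by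
    rintro (a | a)
    · exact arcSign_eq j a
    · simp
  have ht₃ : ∀ x, Sum.elim (arcSign j) (-1 : Fin n → ℝ) x = 1
      ∨ Sum.elim (arcSign j) (-1 : Fin n → ℝ) x = -1 := by
    rintro (a | a)
    · exact arcSign_eq j a
    · simp
  have hA₂ := sAdj_wC2_switch hn hj hgap'
  have hA₃ := sAdj_wC3_switch hn hj hgap'
  refine ⟨?_, ?_⟩
  · rw [sLap_charpoly_switch ht₂ hA₂, sLap_charpoly_switch ht₃ hA₃]
    exact adjTwo_adjThree_cospectral hne h₁ h₂
  · rintro ⟨σ, hσ⟩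
    have hdeg : ∑ y, |adjThree i j (σ (Sum.inl i)) y| = ∑ y, |adjTwo i j (Sum.inl i) y| := by
      rw [← Equiv.sum_comp σ]
      refine Finset.sum_congr rfl fun y _ => ?_
      rw [← abs_sAdj_switch ht₃ hA₃, ← abs_sAdj_switch ht₂ hA₂, hσ]
    rw [degree_adjTwo hne h₁ h₂, degree_adjThree hne h₁ h₂] at hdeg
    generalize σ (Sum.inl i) = x at hdeg
    rcases x with a | a
    · simp only [Sum.elim_inl, if_true, if_neg hne] at hdeg
      by_cases hai : a = i
      · norm_num [hai, hne] at hdeg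
      · split_ifs at hdeg <;> norm_num at hdeg
    · simp only [Sum.elim_inl, Sum.elim_inr, if_true, if_neg hne] at hdeg
      split_ifs at hdeg <;> norm_num at hdeg
end

section
/- Let B₁, B₂ : Matrix (Fin n) (Fin m) ℝ be incidence matrices of two signed graphs Γ₁, Γ₂ that are Laplacian cospectral, i.e. charpoly(B₁ * B₁ᵀ) = charpoly(B₂ * B₂ᵀ). Then for every positive integer p, the signed graphs S_p(Γ₁) and S_p(Γ₂) are cospectral: charpoly(M_p B₁) = charpoly(M_p B₂). -/
open Matrix

/-- `B` is an incidence matrix of a signed graph: each column has exactly two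
nonzero entries, each equal to `1` or `-1`. -/
def IsIncidence {n m : ℕ} (B : Matrix (Fin n) (Fin m) ℝ) : Prop :=
  ∀ j : Fin m, ∃ a b : Fin n, a ≠ b ∧
    (B a j = 1 ∨ B a j = -1) ∧ (B b j = 1 ∨ B b j = -1) ∧
    ∀ c : Fin n, c ≠ a → c ≠ b → B c j = 0

/-- Adjacency matrix of the signed graph `S_p(Γ)` of Operation 4.1, built from an
incidence matrix `B` of `Γ`. -/
def Mp {n m : ℕ} (p : ℕ) (B : Matrix (Fin n) (Fin m) ℝ) :
    Matrix (Fin n ⊕ (Fin p × Fin m)) (Fin n ⊕ (Fin p × Fin m)) ℝ :=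
  Matrix.of fun x y =>
    match x, y with
    | Sum.inl i, Sum.inr aj => B i aj.2
    | Sum.inr aj, Sum.inl i => B i aj.2
    | _, _ => 0

/-- The copies of `B` placed side by side have Gram matrix `p` times that of `B`. -/
theorem copies_mul_transpose {n m : ℕ} (p : ℕ) (B : Matrix (Fin n) (Fin m) ℝ) :
    (B.submatrix id (Prod.snd : Fin p × Fin m → Fin m)) *
      (B.submatrix id (Prod.snd : Fin p × Fin m → Fin m))ᵀ = (p : ℝ) • (B * Bᵀ) := by
  ext i j
  simp [Matrix.mul_apply, Fintype.sum_prod_type]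

theorem Mp_eq_fromBlocks {n m : ℕ} (p : ℕ) (B : Matrix (Fin n) (Fin m) ℝ) :
    Mp p B = fromBlocks 0 (B.submatrix id Prod.snd) (B.submatrix id Prod.snd)ᵀ 0 := by
  ext (i | i) (j | j) <;> rfl

/-- The characteristic polynomial of an off-diagonal block matrix, up to a power of `t`. -/
theorem eval_charpoly_fromBlocks_zero_mul_pow {R k l : Type*} [CommRing R]
    [Fintype k] [DecidableEq k] [Fintype l] [DecidableEq l]
    (C : Matrix k l R) (D : Matrix l k R) (t : R) :
    (fromBlocks 0 C D 0).charpoly.eval t * t ^ Fintype.card k =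
      (scalar k (t ^ 2) - C * D).det * t ^ Fintype.card l := by
  have h : (scalar (k ⊕ l) t - fromBlocks 0 C D 0) * fromBlocks (scalar k t) 0 D 1 =
      fromBlocks (scalar k (t ^ 2) - C * D) (-C) 0 (scalar l t) := by
    have hs : scalar (k ⊕ l) t = fromBlocks (scalar k t) 0 0 (scalar l t) := by
      simp
    rw [hs, sub_eq_add_neg, fromBlocks_neg, fromBlocks_add, fromBlocks_multiply]
    congr 1
    · simp [pow_two, sub_eq_add_neg]
    · simp
    · simp [← smul_eq_mul_diagonal, ← smul_eq_diagonal_mul]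
    · simp
  have hd := congrArg det h
  rw [det_mul, det_fromBlocks_zero₁₂, det_fromBlocks_zero₂₁] at hd
  simpa [eval_charpoly] using hd

theorem eval_charpoly_Mp_mul_pow {n m : ℕ} {p : ℕ} (hp : p ≠ 0)
    (B : Matrix (Fin n) (Fin m) ℝ) (t : ℝ) :
    (Mp p B).charpoly.eval t * t ^ n =
      (p : ℝ) ^ n * (B * Bᵀ).charpoly.eval (t ^ 2 / p) * t ^ (p * m) := by
  have h := eval_charpoly_fromBlocks_zero_mul_pow
    (B.submatrix id (Prod.snd : Fin p × Fin m → Fin m)) (B.submatrix id Prod.snd)ᵀ t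
  have hs : scalar (Fin n) (t ^ 2) - (p : ℝ) • (B * Bᵀ) =
      (p : ℝ) • (scalar (Fin n) (t ^ 2 / p) - B * Bᵀ) := by
    have hp' : (p : ℝ) ≠ 0 := Nat.cast_ne_zero.mpr hp
    rw [smul_sub]
    congr 1
    ext i j
    by_cases hij : i = j
    · simp [hij, mul_div_cancel₀ _ hp']
    · simp [hij]
  rw [copies_mul_transpose, hs, det_smul, ← eval_charpoly] at h
  simpa [Mp_eq_fromBlocks] using h

/-- Corollary 4.5(i): if `Γ₁` and `Γ₂` are Laplacian cospectral signed graphs, then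
`S_p(Γ₁)` and `S_p(Γ₂)` are cospectral. -/
theorem Mp_cospectral_of_laplacianCospectral {n m : ℕ}
    (B₁ B₂ : Matrix (Fin n) (Fin m) ℝ)
    (h₁ : IsIncidence B₁) (h₂ : IsIncidence B₂)
    (hL : (B₁ * B₁ᵀ).charpoly = (B₂ * B₂ᵀ).charpoly)
    (p : ℕ) (hp : 0 < p) :
    (Mp p B₁).charpoly = (Mp p B₂).charpoly := by
  have hX : (Polynomial.X : Polynomial ℝ) ^ n ≠ 0 := pow_ne_zero _ Polynomial.X_ne_zero
  refine mul_right_cancel₀ hX (Polynomial.funext fun t => ?_)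
  simp only [Polynomial.eval_mul, Polynomial.eval_pow, Polynomial.eval_X,
    eval_charpoly_Mp_mul_pow hp.ne', hL]
end

section
/- Let B₁, B₂ : Matrix (Fin n) (Fin m) ℝ be incidence matrices of two signed graphs Γ₁, Γ₂ that are Laplacian cospectral, i.e. charpoly(B₁ * B₁ᵀ) = charpoly(B₂ * B₂ᵀ). Then for every positive integer p and k = p or k = p - 1, the signed graphs S_p^k(Γ₁) and S_p^k(Γ₂) are cospectral: charpoly(N_{p,k} B₁) = charpoly(N_{p,k} B₂). -/
open Matrix

/-- Adjacency matrix of the signed graph `S_p^k(Γ)` of Operation 4.2, built from an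
incidence matrix `B` of `Γ`. -/
def Npk {n m : ℕ} (p k : ℕ) (B : Matrix (Fin n) (Fin m) ℝ) :
    Matrix ((Fin (p + 1) × Fin n) ⊕ (Fin (k + 1) × Fin m))
      ((Fin (p + 1) × Fin n) ⊕ (Fin (k + 1) × Fin m)) ℝ :=
  Matrix.of fun x y =>
    match x, y with
    | Sum.inl ai, Sum.inr bj => B ai.2 bj.2
    | Sum.inr bj, Sum.inl ai => B ai.2 bj.2
    | _, _ => 0

namespace Matrix

open Polynomial

variable {R K m n : Type*} [CommRing R] [Field K]
variable [Fintype m] [DecidableEq m] [Fintype n] [DecidableEq n]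

/-- The characteristic polynomial of a block anti-diagonal matrix, evaluated at `t`, in terms
of the characteristic polynomial of the product of the blocks evaluated at `t ^ 2`. -/
theorem pow_mul_eval_charpoly_fromBlocks_zero_diag (B : Matrix n m R) (C : Matrix m n R) (t : R) :
    t ^ Fintype.card n * (fromBlocks 0 B C 0).charpoly.eval t =
      t ^ Fintype.card m * (B * C).charpoly.eval (t ^ 2) := by
  have key : (scalar (n ⊕ m) t - fromBlocks 0 B C 0) *
      fromBlocks (scalar n t) 0 C (1 : Matrix m m R) =
      fromBlocks (scalar n (t ^ 2) - B * C) (-B) 0 (scalar m t) := by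
    have hs : scalar (n ⊕ m) t = fromBlocks (scalar n t) 0 0 (scalar m t) := by
      simp [fromBlocks_diagonal]
    have hneg : -fromBlocks 0 B C 0 =
        fromBlocks (0 : Matrix n n R) (-B) (-C) (0 : Matrix m m R) := by
      simp [fromBlocks_neg]
    rw [hs, sub_eq_add_neg, hneg, fromBlocks_add, fromBlocks_multiply]
    congr 1
    · simp [pow_two, sub_eq_add_neg]
    · simp
    · simp [← smul_one_eq_diagonal]
    · simp
  have hdet := congrArg det key
  rw [det_mul, det_fromBlocks_zero₁₂, det_fromBlocks_zero₂₁] at hdet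
  simp only [det_one, mul_one, scalar_apply, det_diagonal, Finset.prod_const,
    Finset.card_univ] at hdet
  rw [eval_charpoly, eval_charpoly]
  simp only [scalar_apply]
  linear_combination hdet

theorem charpoly_fromBlocks_zero_diag_congr [Infinite K] {B B' : Matrix n m K}
    {C C' : Matrix m n K} (h : (B * C).charpoly = (B' * C').charpoly) :
    (fromBlocks 0 B C 0).charpoly = (fromBlocks 0 B' C' 0).charpoly := by
  refine mul_left_cancel₀ (pow_ne_zero (Fintype.card n) X_ne_zero) (Polynomial.funext fun t => ?_)
  simp only [eval_mul, eval_pow, eval_X]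
  rw [pow_mul_eval_charpoly_fromBlocks_zero_diag, pow_mul_eval_charpoly_fromBlocks_zero_diag, h]

theorem eval_charpoly_smul (c t : R) (M : Matrix n n R) :
    (c • M).charpoly.eval (c * t) = c ^ Fintype.card n * M.charpoly.eval t := by
  rw [eval_charpoly, eval_charpoly, ← det_smul]
  congr 1
  rw [smul_sub, ← smul_eq_mul, scalar_apply, scalar_apply, ← smul_one_eq_diagonal,
    ← smul_one_eq_diagonal, smul_assoc]

theorem charpoly_smul_congr [Infinite K] {M N : Matrix n n K} (h : M.charpoly = N.charpoly)
    {c : K} (hc : c ≠ 0) : (c • M).charpoly = (c • N).charpoly := by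
  refine Polynomial.funext fun t => ?_
  rw [← mul_div_cancel₀ t hc]
  rw [eval_charpoly_smul, eval_charpoly_smul, h]

end Matrix

/-- The matrix stacking `q` copies of the identity matrix of size `n`. -/
def stackedOne (q n : ℕ) : Matrix (Fin q × Fin n) (Fin n) ℝ :=
  (1 : Matrix (Fin n) (Fin n) ℝ).submatrix Prod.snd id

theorem stackedOne_mul {q n : ℕ} {l : Type*} (A : Matrix (Fin n) l ℝ) :
    stackedOne q n * A = A.submatrix Prod.snd id := by
  ext i j
  simp [stackedOne, Matrix.mul_apply, Matrix.one_apply]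

theorem stackedOne_transpose_mul_self (q n : ℕ) :
    (stackedOne q n)ᵀ * stackedOne q n = (q : ℝ) • (1 : Matrix (Fin n) (Fin n) ℝ) := by
  ext i j
  simp [stackedOne, Matrix.mul_apply, Matrix.one_apply, Fintype.sum_prod_type]
  split_ifs <;> simp

theorem Npk_eq_fromBlocks {n m : ℕ} (p k : ℕ) (B : Matrix (Fin n) (Fin m) ℝ) :
    Npk p k B = fromBlocks 0 (stackedOne (p + 1) n * B * (stackedOne (k + 1) m)ᵀ)
      (stackedOne (p + 1) n * B * (stackedOne (k + 1) m)ᵀ)ᵀ 0 := by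
  have h : stackedOne (p + 1) n * B * (stackedOne (k + 1) m)ᵀ =
      B.submatrix Prod.snd Prod.snd := by
    rw [← transpose_transpose (_ * _), transpose_mul, transpose_transpose, stackedOne_mul,
      stackedOne_mul]
    rfl
  rw [h]
  ext (x | x) (y | y) <;> rfl

theorem X_pow_mul_charpoly_stackedOne_mul {n m : ℕ} (q r : ℕ)
    (B : Matrix (Fin n) (Fin m) ℝ) :
    Polynomial.X ^ n * ((stackedOne q n * B * (stackedOne r m)ᵀ) *
      (stackedOne q n * B * (stackedOne r m)ᵀ)ᵀ).charpoly =
    Polynomial.X ^ (q * n) * (((r : ℝ) * q) • (B * Bᵀ)).charpoly := by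
  have h : (stackedOne q n * B * (stackedOne r m)ᵀ) * (stackedOne q n * B * (stackedOne r m)ᵀ)ᵀ =
      stackedOne q n * ((r : ℝ) • (B * Bᵀ) * (stackedOne q n)ᵀ) := by
    simp only [transpose_mul, transpose_transpose]
    rw [Matrix.mul_assoc _ (stackedOne r m)ᵀ, ← Matrix.mul_assoc (stackedOne r m)ᵀ,
      stackedOne_transpose_mul_self]
    simp [Matrix.mul_assoc]
  have h' := charpoly_mul_comm' (stackedOne q n) ((r : ℝ) • (B * Bᵀ) * (stackedOne q n)ᵀ)
  rw [Matrix.mul_assoc _ (stackedOne q n)ᵀ, stackedOne_transpose_mul_self] at h'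
  simp only [Fintype.card_fin, Fintype.card_prod, Matrix.mul_smul, Matrix.mul_one, smul_smul]
    at h'
  rw [h, h', mul_comm (r : ℝ)]

/-- Corollary 4.5(ii): if `Γ₁` and `Γ₂` are Laplacian cospectral signed graphs, then
`S_p^k(Γ₁)` and `S_p^k(Γ₂)` are cospectral (for `k = p` or `k = p - 1`). -/
theorem Npk_cospectral_of_laplacianCospectral {n m : ℕ}
    (B₁ B₂ : Matrix (Fin n) (Fin m) ℝ)
    (h₁ : IsIncidence B₁) (h₂ : IsIncidence B₂)
    (hL : (B₁ * B₁ᵀ).charpoly = (B₂ * B₂ᵀ).charpoly)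
    (p k : ℕ) (hp : 0 < p) (hk : k = p ∨ k = p - 1) :
    (Npk p k B₁).charpoly = (Npk p k B₂).charpoly := by
  rw [Npk_eq_fromBlocks, Npk_eq_fromBlocks]
  refine charpoly_fromBlocks_zero_diag_congr
    (mul_left_cancel₀ (pow_ne_zero n Polynomial.X_ne_zero) ?_)
  rw [X_pow_mul_charpoly_stackedOne_mul, X_pow_mul_charpoly_stackedOne_mul,
    charpoly_smul_congr hL (by positivity)]
end

section
/- Let B : Matrix (Fin n) (Fin m) ℝ be an incidence matrix of a signed graph Γ such that every eigenvalue of the Laplacian L = B * Bᵀ is the square of a natural number (i.e., writing hL for the fact that L is Hermitian, for every i there exists t : ℕ with hL.eigenvalues i = (t : ℝ)^2). Let p be a positive integer and k = p or k = p - 1, and suppose (p+1)(k+1) = q^2 for some natural number q. Then the signed graph S_p^k(Γ) is integral: every eigenvalue of the symmetric matrix N_{p,k} B is an integer. -/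
open Matrix

/-- A real number with a nonzero eigenvector is listed among the eigenvalues of a Hermitian
matrix. -/
lemma exists_eigenvalues_eq_of_mulVec_eq_smul {ι : Type*} [Fintype ι] [DecidableEq ι]
    {A : Matrix ι ι ℝ} (hA : A.IsHermitian) {v : ι → ℝ} (hv : v ≠ 0) {μ : ℝ}
    (h : A *ᵥ v = μ • v) : ∃ i, hA.eigenvalues i = μ := by
  have hμ : Module.End.HasEigenvalue (Matrix.toLin' A) μ :=
    Module.End.hasEigenvalue_of_hasEigenvector
      (Module.End.hasEigenvector_iff.2 ⟨Module.End.mem_eigenspace_iff.2 (by simpa using h), hv⟩)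
  have hmem := hμ.mem_spectrum
  rwa [Matrix.spectrum_toLin', hA.spectrum_real_eq_range_eigenvalues] at hmem

/-- `Npk p k B` acts on the vertex copies through the sum over the edge copies. -/
lemma Npk_mulVec_inl {n m : ℕ} (p k : ℕ) (B : Matrix (Fin n) (Fin m) ℝ)
    (v : (Fin (p + 1) × Fin n) ⊕ (Fin (k + 1) × Fin m) → ℝ) (a : Fin (p + 1)) (i : Fin n) :
    (Npk p k B *ᵥ v) (Sum.inl (a, i)) = (B *ᵥ fun j => ∑ b, v (Sum.inr (b, j))) i := by
  simp only [Matrix.mulVec, dotProduct, Fintype.sum_sum_type, Npk, Matrix.of_apply, zero_mul,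
    Finset.sum_const_zero, zero_add, Fintype.sum_prod_type_right, Finset.mul_sum]

/-- `Npk p k B` acts on the edge copies through the sum over the vertex copies. -/
lemma Npk_mulVec_inr {n m : ℕ} (p k : ℕ) (B : Matrix (Fin n) (Fin m) ℝ)
    (v : (Fin (p + 1) × Fin n) ⊕ (Fin (k + 1) × Fin m) → ℝ) (b : Fin (k + 1)) (j : Fin m) :
    (Npk p k B *ᵥ v) (Sum.inr (b, j)) = (Bᵀ *ᵥ fun i => ∑ a, v (Sum.inl (a, i))) j := by
  simp only [Matrix.mulVec, dotProduct, Fintype.sum_sum_type, Npk, Matrix.of_apply, zero_mul,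
    Finset.sum_const_zero, add_zero, Fintype.sum_prod_type_right, Finset.mul_sum,
    Matrix.transpose_apply]

/-- An eigenvector of `Npk p k B` for a nonzero eigenvalue `μ` yields an eigenvector `x` of
the Laplacian, up to the factor `(p + 1) * (k + 1)`, for `μ ^ 2`. -/
lemma exists_laplacian_eigenvector_of_Npk {n m : ℕ} {p k : ℕ} {B : Matrix (Fin n) (Fin m) ℝ}
    {v : (Fin (p + 1) × Fin n) ⊕ (Fin (k + 1) × Fin m) → ℝ} (hv : v ≠ 0) {μ : ℝ} (hμ : μ ≠ 0)
    (h : Npk p k B *ᵥ v = μ • v) :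
    ∃ x : Fin n → ℝ, x ≠ 0 ∧
      (((p : ℝ) + 1) * ((k : ℝ) + 1)) • ((B * Bᵀ) *ᵥ x) = μ ^ 2 • x := by
  set x : Fin n → ℝ := fun i => ∑ a, v (Sum.inl (a, i)) with hx
  set y : Fin m → ℝ := fun j => ∑ b, v (Sum.inr (b, j)) with hy
  have hl (a i) : (B *ᵥ y) i = μ * v (Sum.inl (a, i)) := by
    rw [hy, ← Npk_mulVec_inl p k B v a i, h, Pi.smul_apply, smul_eq_mul]
  have hr (b j) : (Bᵀ *ᵥ x) j = μ * v (Sum.inr (b, j)) := by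
    rw [hx, ← Npk_mulVec_inr p k B v b j, h, Pi.smul_apply, smul_eq_mul]
  have hxsum : μ • x = ((p : ℝ) + 1) • (B *ᵥ y) := by
    ext i
    simp [hx, Finset.mul_sum, ← hl]
  have hysum : μ • y = ((k : ℝ) + 1) • (Bᵀ *ᵥ x) := by
    ext j
    simp [hy, Finset.mul_sum, ← hr]
  refine ⟨x, fun hx0 => hv ?_, ?_⟩
  · have hvr (b j) : v (Sum.inr (b, j)) = 0 := by
      simpa [hx0, hμ, eq_comm] using hr b j
    have hy0 : y = 0 := by
      ext j
      simp [hy, hvr]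
    ext (⟨a, i⟩ | ⟨b, j⟩)
    · simpa [hy0, hμ, eq_comm] using hl a i
    · exact hvr b j
  · rw [← Matrix.mulVec_mulVec, mul_smul, ← Matrix.mulVec_smul, ← hysum, Matrix.mulVec_smul,
      smul_comm, ← hxsum, smul_smul, sq]

/-- Corollary 4.7(ii): if all the Laplacian eigenvalues of `Γ` are perfect squares
(squares of natural numbers), `k = p` or `k = p - 1`, and `(p+1)(k+1)` is a perfect
square, then the signed graph `S_p^k(Γ)` is integral: all its adjacency eigenvalues
are integers. -/
theorem Npk_integral {n m : ℕ} (B : Matrix (Fin n) (Fin m) ℝ)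
    (hB : IsIncidence B) (hL : (B * Bᵀ).IsHermitian)
    (hsq : ∀ i, ∃ t : ℕ, hL.eigenvalues i = (t : ℝ) ^ 2)
    (p k : ℕ) (hp : 0 < p) (hk : k = p ∨ k = p - 1)
    (q : ℕ) (hpq : (p + 1) * (k + 1) = q ^ 2)
    (hN : (Npk p k B).IsHermitian) :
    ∀ i, ∃ z : ℤ, hN.eigenvalues i = (z : ℝ) := by
  intro i
  set μ := hN.eigenvalues i
  by_cases hμ : μ = 0
  · exact ⟨0, by simp [hμ]⟩
  have hv : (hN.eigenvectorBasis i).ofLp ≠ 0 := fun h0 =>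
    hN.eigenvectorBasis.orthonormal.ne_zero i (by ext a; exact congrFun h0 a)
  obtain ⟨x, hx, hxe⟩ :=
    exists_laplacian_eigenvector_of_Npk hv hμ (hN.mulVec_eigenvectorBasis i)
  have hpq' : ((p : ℝ) + 1) * ((k : ℝ) + 1) = (q : ℝ) ^ 2 := mod_cast hpq
  have hq : (q : ℝ) ^ 2 ≠ 0 := by
    rw [← hpq']
    positivity
  have hLx : (B * Bᵀ) *ᵥ x = (((q : ℝ) ^ 2)⁻¹ * μ ^ 2) • x := by
    rw [mul_smul, ← hxe, hpq', inv_smul_smul₀ hq]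
  obtain ⟨l, hl⟩ := exists_eigenvalues_eq_of_mulVec_eq_smul hL hx hLx
  obtain ⟨t, ht⟩ := hsq l
  have hsquare : μ ^ 2 = ((q : ℝ) * t) ^ 2 := by
    rw [mul_pow, ← ht, hl, mul_inv_cancel_left₀ hq]
  obtain h | h := sq_eq_sq_iff_eq_or_eq_neg.1 hsquare
  · exact ⟨q * t, by simpa using h⟩
  · exact ⟨-(q * t), by simpa using h⟩
end

section
/- Let n ≥ 1 and let B : Matrix (Fin n) (Fin n) ℝ be an incidence matrix of an unbalanced unicyclic signed graph Γ (so Γ has n vertices and n edges), and assume the Laplacian L = B * Bᵀ is positive definite (all Laplacian eigenvalues μ₁ ≥ ⋯ ≥ μₙ are positive). Let M be the adjacency matrix of the subdivision signed graph S(Γ): the symmetric matrix on Fin n ⊕ Fin n whose (Sum.inl i, Sum.inr j) and (Sum.inr j, Sum.inl i) entries equal B i j and whose other entries are 0. Let K = !![0, 1; 1, 0] : Matrix (Fin 2) (Fin 2) ℝ be the adjacency matrix of K₂, and set M_× = (M ⊗ₖ 1) + (1 ⊗ₖ K) (Kronecker products; the adjacency matrix of the Cartesian product S(Γ) × K₂)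 and M_⊗ = M ⊗ₖ K (the adjacency matrix of the Kronecker product S(Γ) ⊗ K₂). Then M_× and M_⊗ are noncospectral and equienergetic — that is, charpoly(M_×) ≠ charpoly(M_⊗) and energy(M_×) = energy(M_⊗) — if and only if every eigenvalue of B * Bᵀ is at least 1 (i.e. μₙ ≥ 1). -/
open Matrix
open scoped Kronecker

/-- Adjacency matrix of the subdivision signed graph `S(Γ)`, built from an
incidence matrix `B` of `Γ`. -/
def subdivAdj {n m : ℕ} (B : Matrix (Fin n) (Fin m) ℝ) :
    Matrix (Fin n ⊕ Fin m) (Fin n ⊕ Fin m) ℝ :=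
  Matrix.of fun x y =>
    match x, y with
    | Sum.inl i, Sum.inr j => B i j
    | Sum.inr j, Sum.inl i => B i j
    | _, _ => 0

/-- The adjacency matrix of `K₂`. -/
def K2 : Matrix (Fin 2) (Fin 2) ℝ := !![0, 1; 1, 0]

/-- The energy of a real symmetric matrix: the sum of the absolute values of its
eigenvalues, listed with multiplicity. -/
noncomputable def energy {N : Type*} [Fintype N] [DecidableEq N]
    (A : Matrix N N ℝ) : ℝ := by
  classical exact if h : A.IsHermitian then ∑ i, |h.eigenvalues i| else 0

/-- A matrix similar to `diagonal d` has characteristic polynomial `∏ i, (X - C (d i))`. -/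
theorem charpoly_of_eq_mul_diagonal_mul {N : Type*} [Fintype N] [DecidableEq N]
    {A P Q : Matrix N N ℝ} {d : N → ℝ} (hPQ : P * Q = 1) (hA : A = P * diagonal d * Q) :
    A.charpoly = ∏ i, (Polynomial.X - Polynomial.C (d i)) := by
  rw [hA, charpoly_mul_comm, ← Matrix.mul_assoc, mul_eq_one_comm.mp hPQ, Matrix.one_mul,
    charpoly_diagonal]

theorem roots_prod_X_sub_C_univ {N : Type*} [Fintype N] (d : N → ℝ) :
    (∏ i, (Polynomial.X - Polynomial.C (d i))).roots = Finset.univ.val.map d := by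
  rw [← Polynomial.roots_multiset_prod_X_sub_C (Finset.univ.val.map d), Multiset.map_map]
  rfl

/-- The energy of a symmetric matrix can be read off from the roots of its characteristic
polynomial. -/
theorem energy_of_charpoly_eq {N : Type*} [Fintype N] [DecidableEq N]
    {A : Matrix N N ℝ} (hA : A.IsHermitian) {d : N → ℝ}
    (h : A.charpoly = ∏ i, (Polynomial.X - Polynomial.C (d i))) :
    energy A = ∑ i, |d i| := by
  have hroots := hA.roots_charpoly_eq_eigenvalues
  rw [h, roots_prod_X_sub_C_univ] at hroots
  have := congrArg (fun s : Multiset ℝ => (s.map abs).sum) hroots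
  simp only [Multiset.map_map] at this
  rw [energy, dif_pos hA]
  exact this.symm

theorem sum_sq_eq_of_prod_X_sub_C_eq {N : Type*} [Fintype N] {d e : N → ℝ}
    (h : ∏ i, (Polynomial.X - Polynomial.C (d i)) = ∏ i, (Polynomial.X - Polynomial.C (e i))) :
    ∑ i, d i ^ 2 = ∑ i, e i ^ 2 := by
  have hroots := congrArg Polynomial.roots h
  rw [roots_prod_X_sub_C_univ, roots_prod_X_sub_C_univ] at hroots
  have := congrArg (fun s : Multiset ℝ => (s.map (· ^ 2)).sum) hroots
  simp only [Multiset.map_map] at this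
  exact this

theorem Matrix.IsHermitian.exists_eq_mul_diagonal_mul {N : Type*} [Fintype N] [DecidableEq N]
    {A : Matrix N N ℝ} (hA : A.IsHermitian) :
    ∃ P Q : Matrix N N ℝ, P * Q = 1 ∧ A = P * diagonal hA.eigenvalues * Q := by
  refine ⟨hA.eigenvectorUnitary, star (hA.eigenvectorUnitary : Matrix N N ℝ), by simp, ?_⟩
  conv_lhs => rw [hA.spectral_theorem, Unitary.conjStarAlgAut_apply]
  rfl

theorem K2_eq_mul_diagonal_mul :
    K2 = !![1, 1; 1, -1] * diagonal ![1, -1] * !![1 / 2, 1 / 2; 1 / 2, -1 / 2] := by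
  ext i j
  fin_cases i <;> fin_cases j <;>
    simp [K2, Matrix.mul_apply, Fin.sum_univ_two, vecMul_diagonal] <;> norm_num

theorem K2_eigenbasis_mul_inv :
    (!![1, 1; 1, -1] * !![1 / 2, 1 / 2; 1 / 2, -1 / 2] : Matrix (Fin 2) (Fin 2) ℝ) = 1 := by
  ext i j
  fin_cases i <;> fin_cases j <;> norm_num [Matrix.mul_apply, Fin.sum_univ_two]

theorem K2_isHermitian : K2.IsHermitian := by
  ext i j
  fin_cases i <;> fin_cases j <;> simp [K2]

/-- The characteristic polynomial of the Cartesian product with `K₂`. -/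
theorem charpoly_cartesian_K2 {N : Type*} [Fintype N] [DecidableEq N]
    {A : Matrix N N ℝ} (hA : A.IsHermitian) :
    (A ⊗ₖ (1 : Matrix (Fin 2) (Fin 2) ℝ) + (1 : Matrix N N ℝ) ⊗ₖ K2).charpoly =
      ∏ x : N × Fin 2, (Polynomial.X -
        Polynomial.C (hA.eigenvalues x.1 + (![1, -1] : Fin 2 → ℝ) x.2)) := by
  obtain ⟨P, Q, hPQ, h⟩ := hA.exists_eq_mul_diagonal_mul
  refine charpoly_of_eq_mul_diagonal_mul (P := P ⊗ₖ !![1, 1; 1, -1])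
    (Q := Q ⊗ₖ !![1 / 2, 1 / 2; 1 / 2, -1 / 2]) ?_ ?_
  · rw [← mul_kronecker_mul, hPQ, K2_eigenbasis_mul_inv, one_kronecker_one]
  · have hd : diagonal (fun x : N × Fin 2 => hA.eigenvalues x.1 + (![1, -1] : Fin 2 → ℝ) x.2) =
        diagonal hA.eigenvalues ⊗ₖ 1 + 1 ⊗ₖ diagonal ![1, -1] := by
      rw [← diagonal_one, ← diagonal_one, diagonal_kronecker_diagonal,
        diagonal_kronecker_diagonal, diagonal_add]
      simp
    rw [hd, Matrix.mul_add, Matrix.add_mul, ← mul_kronecker_mul, ← mul_kronecker_mul,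
      ← mul_kronecker_mul, ← mul_kronecker_mul, ← h, ← K2_eq_mul_diagonal_mul, Matrix.mul_one,
      Matrix.mul_one, hPQ, K2_eigenbasis_mul_inv]

/-- The characteristic polynomial of the Kronecker product with `K₂`. -/
theorem charpoly_kronecker_K2 {N : Type*} [Fintype N] [DecidableEq N]
    {A : Matrix N N ℝ} (hA : A.IsHermitian) :
    (A ⊗ₖ K2).charpoly =
      ∏ x : N × Fin 2, (Polynomial.X -
        Polynomial.C (hA.eigenvalues x.1 * (![1, -1] : Fin 2 → ℝ) x.2)) := by
  obtain ⟨P, Q, hPQ, h⟩ := hA.exists_eq_mul_diagonal_mul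
  refine charpoly_of_eq_mul_diagonal_mul (P := P ⊗ₖ !![1, 1; 1, -1])
    (Q := Q ⊗ₖ !![1 / 2, 1 / 2; 1 / 2, -1 / 2]) ?_ ?_
  · rw [← mul_kronecker_mul, hPQ, K2_eigenbasis_mul_inv, one_kronecker_one]
  · rw [← diagonal_kronecker_diagonal, ← mul_kronecker_mul, ← mul_kronecker_mul, ← h,
      ← K2_eq_mul_diagonal_mul]

theorem charpoly_cartesian_K2_ne_charpoly_kronecker_K2 {N : Type*} [Fintype N] [DecidableEq N]
    [Nonempty N] {A : Matrix N N ℝ} (hA : A.IsHermitian) :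
    (A ⊗ₖ (1 : Matrix (Fin 2) (Fin 2) ℝ) + (1 : Matrix N N ℝ) ⊗ₖ K2).charpoly ≠
      (A ⊗ₖ K2).charpoly := by
  rw [charpoly_cartesian_K2 hA, charpoly_kronecker_K2 hA]
  intro h
  refine (Finset.sum_lt_sum_of_nonempty (s := (Finset.univ : Finset N)) Finset.univ_nonempty
    fun i _ => ?_).ne' (by simpa only [Fintype.sum_prod_type] using sum_sq_eq_of_prod_X_sub_C_eq h)
  simp only [Fin.sum_univ_two, cons_val_zero, cons_val_one]
  linarith

theorem two_mul_abs_le_abs_add_one_add_abs_sub_one (a : ℝ) : 2 * |a| ≤ |a + 1| + |a + -1| := by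
  have := abs_add_le (a + 1) (a + -1)
  rw [show a + 1 + (a + -1) = 2 * a by ring, abs_mul, abs_two] at this
  exact this

theorem abs_add_one_add_abs_sub_one_eq_iff (a : ℝ) :
    2 * |a| = |a + 1| + |a + -1| ↔ 1 ≤ a ^ 2 := by
  rw [one_le_sq_iff_one_le_abs]
  constructor <;> intro h <;>
    cases abs_cases a <;> cases abs_cases (a + 1) <;> cases abs_cases (a + -1) <;> linarith

/-- The Cartesian and Kronecker products with `K₂` have the same energy exactly when every
eigenvalue has absolute value at least `1`. -/
theorem energy_cartesian_K2_eq_energy_kronecker_K2_iff {N : Type*} [Fintype N] [DecidableEq N]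
    {A : Matrix N N ℝ} (hA : A.IsHermitian) :
    energy (A ⊗ₖ (1 : Matrix (Fin 2) (Fin 2) ℝ) + (1 : Matrix N N ℝ) ⊗ₖ K2) =
      energy (A ⊗ₖ K2) ↔ ∀ i, 1 ≤ hA.eigenvalues i ^ 2 := by
  have hkron : (A ⊗ₖ K2).IsHermitian := by
    rw [IsHermitian, conjTranspose_kronecker, hA.eq, K2_isHermitian.eq]
  have hcart : (A ⊗ₖ (1 : Matrix (Fin 2) (Fin 2) ℝ) +
      (1 : Matrix N N ℝ) ⊗ₖ K2).IsHermitian := by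
    rw [IsHermitian, conjTranspose_add, conjTranspose_kronecker, conjTranspose_kronecker, hA.eq,
      K2_isHermitian.eq, conjTranspose_one, conjTranspose_one]
  rw [energy_of_charpoly_eq hcart (charpoly_cartesian_K2 hA),
    energy_of_charpoly_eq hkron (charpoly_kronecker_K2 hA), Fintype.sum_prod_type,
    Fintype.sum_prod_type, eq_comm]
  simp only [Fin.sum_univ_two, cons_val_zero, cons_val_one, mul_one, mul_neg, abs_neg, ← two_mul]
  rw [Finset.sum_eq_sum_iff_of_le
    fun i _ => two_mul_abs_le_abs_add_one_add_abs_sub_one (hA.eigenvalues i)]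
  simp only [Finset.mem_univ, forall_true_left, abs_add_one_add_abs_sub_one_eq_iff]

theorem subdivAdj_eq_fromBlocks {n m : ℕ} (B : Matrix (Fin n) (Fin m) ℝ) :
    subdivAdj B = fromBlocks 0 B Bᵀ 0 := by
  ext (i | i) (j | j) <;> rfl

theorem subdivAdj_isHermitian {n m : ℕ} (B : Matrix (Fin n) (Fin m) ℝ) :
    (subdivAdj B).IsHermitian := by
  ext (i | i) (j | j) <;> simp [subdivAdj]

/-- For a square incidence matrix, the squares of the eigenvalues of the subdivision are the
Laplacian eigenvalues, with doubled multiplicity. -/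
theorem prod_X_sub_C_eigenvalues_subdivAdj_sq {n : ℕ} (B : Matrix (Fin n) (Fin n) ℝ) :
    ∏ i, (Polynomial.X - Polynomial.C ((subdivAdj_isHermitian B).eigenvalues i ^ 2)) =
      (B * Bᵀ).charpoly * (B * Bᵀ).charpoly := by
  obtain ⟨P, Q, hPQ, h⟩ := (subdivAdj_isHermitian B).exists_eq_mul_diagonal_mul
  have hsq : subdivAdj B * subdivAdj B =
      P * diagonal (fun i => (subdivAdj_isHermitian B).eigenvalues i ^ 2) * Q := by
    calc subdivAdj B * subdivAdj B
        = P * diagonal (subdivAdj_isHermitian B).eigenvalues * (Q * P) *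
            diagonal (subdivAdj_isHermitian B).eigenvalues * Q := by
          conv_lhs => rw [h]
          simp only [Matrix.mul_assoc]
      _ = _ := by
          rw [mul_eq_one_comm.mp hPQ, Matrix.mul_one, Matrix.mul_assoc P, diagonal_mul_diagonal]
          simp only [sq]
  rw [← charpoly_of_eq_mul_diagonal_mul hPQ hsq, subdivAdj_eq_fromBlocks, fromBlocks_multiply]
  simp only [Matrix.zero_mul, Matrix.mul_zero, zero_add, add_zero]
  rw [charpoly_fromBlocks_zero₁₂, charpoly_mul_comm Bᵀ B]

theorem one_le_sq_eigenvalues_subdivAdj_iff {n : ℕ} {B : Matrix (Fin n) (Fin n) ℝ}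
    (hL : (B * Bᵀ).IsHermitian) :
    (∀ i, 1 ≤ (subdivAdj_isHermitian B).eigenvalues i ^ 2) ↔ ∀ i, 1 ≤ hL.eigenvalues i := by
  have h := prod_X_sub_C_eigenvalues_subdivAdj_sq B
  rw [hL.charpoly_eq] at h
  have key (x : ℝ) : (∃ i, x = (subdivAdj_isHermitian B).eigenvalues i ^ 2) ↔
      ∃ i, x = hL.eigenvalues i := by
    have := congrArg (Polynomial.eval x · = 0) h
    simpa [Polynomial.eval_prod, Finset.prod_eq_zero_iff, sub_eq_zero] using this
  constructor
  · intro H i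
    obtain ⟨j, hj⟩ := (key _).mpr ⟨i, rfl⟩
    exact hj ▸ H j
  · intro H i
    obtain ⟨j, hj⟩ := (key _).mp ⟨i, rfl⟩
    exact hj ▸ H j

/-- Theorem 4.10: for an unbalanced unicyclic signed graph `Γ` (here: `n` vertices,
`n` edges, positive-definite Laplacian `L = B Bᵀ`), the signed graphs
`S(Γ) × K₂` (Cartesian product, adjacency `M ⊗ₖ 1 + 1 ⊗ₖ K₂`) and `S(Γ) ⊗ K₂`
(Kronecker product, adjacency `M ⊗ₖ K₂`) are noncospectral and equienergetic if and
only if every Laplacian eigenvalue of `Γ` is at least `1`. -/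
theorem subdiv_cartesian_kronecker_noncospectral_equienergetic_iff
    {n : ℕ} (hn : 1 ≤ n) (B : Matrix (Fin n) (Fin n) ℝ)
    (hB : IsIncidence B) (hPD : (B * Bᵀ).PosDef) :
    ((subdivAdj B ⊗ₖ (1 : Matrix (Fin 2) (Fin 2) ℝ) +
        (1 : Matrix (Fin n ⊕ Fin n) (Fin n ⊕ Fin n) ℝ) ⊗ₖ K2).charpoly ≠
          (subdivAdj B ⊗ₖ K2).charpoly ∧
      energy (subdivAdj B ⊗ₖ (1 : Matrix (Fin 2) (Fin 2) ℝ) +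
        (1 : Matrix (Fin n ⊕ Fin n) (Fin n ⊕ Fin n) ℝ) ⊗ₖ K2) =
          energy (subdivAdj B ⊗ₖ K2)) ↔
    ∀ i, 1 ≤ hPD.isHermitian.eigenvalues i := by
  have : NeZero n := ⟨by omega⟩
  rw [energy_cartesian_K2_eq_energy_kronecker_K2_iff (subdivAdj_isHermitian B),
    one_le_sq_eigenvalues_subdivAdj_iff hPD.isHermitian]
  exact and_iff_right
    (charpoly_cartesian_K2_ne_charpoly_kronecker_K2 (subdivAdj_isHermitian B))
end
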